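/- arXiv:2405.17577 — 3 statements merged into one kernel-verified Lean document; each statement's English description precedes it below -/
import Mathlib

section
/- Let n ≥ 4 be an integer and m > 0, Λ > 0 real numbers, and let r* = (m(n−3)/Λ)^{1/(n−1)}. Then f(r*) > 0 if and only if m² Λ^{n−3} < (n−3)^{n−3}/(n−1)^{n−1}. -/
/-- At a positive critical radius, `Λ r^(k+2) = m k`, the profile takes the value
`1 - Λ r² (k+2)/k`. -/
theorem profile_eq_of_critical {m Λ r : ℝ} {k : ℕ} (hk : 0 < k) (hr : 0 < r)
    (hcrit : Λ * r ^ (k + 2) = m * k) :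
    1 - 2 * m * (r ^ k)⁻¹ - Λ * r ^ 2 = 1 - Λ * r ^ 2 * (k + 2) / k := by
  have hk' : (0 : ℝ) < k := by exact_mod_cast hk
  have hm : m = Λ * r ^ (k + 2) / k := by rw [hcrit]; field_simp
  rw [hm, pow_add]
  field_simp
  ring

theorem critical_lt_iff {m Λ r : ℝ} {k : ℕ} (hk : 0 < k) (hΛ : 0 < Λ)
    (hcrit : Λ * r ^ (k + 2) = m * k) :
    Λ * r ^ 2 * (k + 2) < k ↔ m ^ 2 * Λ ^ k < (k : ℝ) ^ k / ((k : ℝ) + 2) ^ (k + 2) := by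
  have hk' : (0 : ℝ) < k := by exact_mod_cast hk
  have hpow : (Λ * r ^ 2 * (k + 2)) ^ (k + 2)
      = m ^ 2 * Λ ^ k * ((k : ℝ) + 2) ^ (k + 2) * (k : ℝ) ^ 2 := by
    calc (Λ * r ^ 2 * (k + 2)) ^ (k + 2)
        = (Λ * r ^ (k + 2)) ^ 2 * Λ ^ k * ((k : ℝ) + 2) ^ (k + 2) := by
          rw [mul_pow, mul_pow, ← pow_mul]; ring
      _ = _ := by rw [hcrit]; ring
  rw [lt_div_iff₀ (by positivity),
    ← pow_lt_pow_iff_left₀ (by positivity) hk'.le (Nat.succ_ne_zero (k + 1)), hpow,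
    pow_add (k : ℝ) k 2, mul_lt_mul_iff_left₀ (by positivity)]

/-- For `Λ > 0` and `r* = (m(n-3)/Λ)^(1/(n-1))`, one has `f(r*) > 0` iff
`m² Λ^(n-3) < (n-3)^(n-3)/(n-1)^(n-1)`. -/
theorem stmt_3 (n : ℕ) (hn : 4 ≤ n) (m Λ : ℝ) (hm : 0 < m) (hΛ : 0 < Λ)
    (f : ℝ → ℝ)
    (hf : ∀ r : ℝ, 0 < r → f r = 1 - 2 * m * r ^ ((3 : ℤ) - (n : ℤ)) - Λ * r ^ 2)
    (rstar : ℝ) (hrs : rstar = (m * ((n : ℝ) - 3) / Λ) ^ (1 / ((n : ℝ) - 1))) :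
    0 < f rstar ↔
      m ^ 2 * Λ ^ (n - 3) < ((n : ℝ) - 3) ^ (n - 3) / ((n : ℝ) - 1) ^ (n - 1) := by
  obtain ⟨k, rfl⟩ : ∃ k, n = k + 3 := ⟨n - 3, by omega⟩
  have hk : 0 < k := by omega
  have hk' : (0 : ℝ) < k := by exact_mod_cast hk
  have h3 : ((k + 3 : ℕ) : ℝ) - 3 = k := by push_cast; ring
  have h1 : ((k + 3 : ℕ) : ℝ) - 1 = k + 2 := by push_cast; ring
  have hz : (3 : ℤ) - ((k + 3 : ℕ) : ℤ) = -(k : ℤ) := by push_cast; ring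
  rw [h3, h1] at hrs
  rw [h3, h1, show k + 3 - 3 = k by omega, show k + 3 - 1 = k + 2 by omega]
  have hpos : 0 < m * (k : ℝ) / Λ := by positivity
  have hr : 0 < rstar := hrs ▸ Real.rpow_pos_of_pos hpos _
  have hcrit : Λ * rstar ^ (k + 2) = m * k := by
    have hroot : rstar ^ (k + 2) = m * k / Λ := by
      rw [hrs, ← Real.rpow_natCast, ← Real.rpow_mul hpos.le]
      push_cast
      rw [one_div_mul_cancel (by positivity), Real.rpow_one]
    rw [hroot]
    field_simp
  rw [hf rstar hr, hz, zpow_neg, zpow_natCast, profile_eq_of_critical hk hr hcrit, sub_pos,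
    div_lt_one hk', critical_lt_iff hk hΛ hcrit]
end

section
/- Let n ≥ 4 be an integer and m > 0, Λ > 0 real numbers satisfying m² Λ^{n−3} < (n−3)^{n−3}/(n−1)^{n−1}, and let r* = (m(n−3)/Λ)^{1/(n−1)}. Then there exist real numbers r₀, r₁ with 0 < r₀ < r* < r₁ such that f(r₀) = f(r₁) = 0, f(r) > 0 for r ∈ (r₀, r₁), f(r) < 0 for r ∈ (0, r₀) and for r ∈ (r₁, ∞); in particular r₀ and r₁ are the only zeros of f in (0, ∞). -/
open Set

/-- A continuous function on `(0, ∞)` that increases strictly up to `c`, decreases strictly from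
`c` on, is positive at `c` and takes negative values on both sides of `c`, has exactly two
zeros, with the expected signs in between. -/
theorem exists_two_zeros_of_unimodal {F : ℝ → ℝ} {a b c : ℝ} (ha : 0 < a) (hac : a ≤ c)
    (hcb : c ≤ b) (hcont : ContinuousOn F (Ioi 0)) (hmono : StrictMonoOn F (Ioc 0 c))
    (hanti : StrictAntiOn F (Ici c)) (hFa : F a < 0) (hFb : F b < 0) (hFc : 0 < F c) :
    ∃ r₀ r₁ : ℝ, 0 < r₀ ∧ r₀ < c ∧ c < r₁ ∧ F r₀ = 0 ∧ F r₁ = 0 ∧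
      (∀ r ∈ Ioo r₀ r₁, 0 < F r) ∧ (∀ r ∈ Ioo 0 r₀, F r < 0) ∧ (∀ r, r₁ < r → F r < 0) := by
  have hc : 0 < c := ha.trans_le hac
  obtain ⟨r₀, ⟨har₀, hr₀c⟩, hr₀⟩ := intermediate_value_Ioo hac
    (hcont.mono fun x hx => ha.trans_le hx.1) ⟨hFa, hFc⟩
  obtain ⟨r₁, ⟨hcr₁, -⟩, hr₁⟩ := intermediate_value_Ioo' hcb
    (hcont.mono fun x hx => hc.trans_le hx.1) ⟨hFb, hFc⟩
  have hr₀pos : 0 < r₀ := ha.trans har₀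
  refine ⟨r₀, r₁, hr₀pos, hr₀c, hcr₁, hr₀, hr₁, ?_, ?_, ?_⟩
  · rintro r ⟨h₀, h₁⟩
    rcases le_total r c with h | h
    · exact hr₀ ▸ hmono ⟨hr₀pos, hr₀c.le⟩ ⟨hr₀pos.trans h₀, h⟩ h₀
    · exact hr₁ ▸ hanti h hcr₁.le h₁
  · rintro r ⟨h₀, h₁⟩
    exact hr₀ ▸ hmono ⟨h₀, (h₁.trans hr₀c).le⟩ ⟨hr₀pos, hr₀c.le⟩ h₁
  · intro r h
    exact hr₁ ▸ hanti hcr₁.le (hcr₁.trans h).le h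

/-- The profile function in dimension `k + 3`. -/
noncomputable def profile (k : ℕ) (m Λ r : ℝ) : ℝ := 1 - 2 * m / r ^ k - Λ * r ^ 2

theorem hasDerivAt_profile (k : ℕ) (m Λ : ℝ) {r : ℝ} (hr : 0 < r) :
    HasDerivAt (profile k m Λ) (2 / r ^ (k + 1) * (m * k - Λ * r ^ (k + 2))) r := by
  have h := (((hasDerivAt_const r (2 * m)).div (hasDerivAt_pow k r) (pow_pos hr k).ne').const_sub
    1).sub ((hasDerivAt_pow 2 r).const_mul Λ)
  refine h.congr_deriv ?_
  rcases k with _ | k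
  · field_simp
    simp
    ring
  · simp only [Nat.add_sub_cancel]
    field_simp
    push_cast
    ring

theorem continuousOn_profile (k : ℕ) (m Λ : ℝ) : ContinuousOn (profile k m Λ) (Ioi 0) :=
  fun _ hr => (hasDerivAt_profile k m Λ hr).continuousAt.continuousWithinAt

theorem strictMonoOn_profile {k : ℕ} {m Λ c : ℝ} (hΛ : 0 < Λ) (hc : Λ * c ^ (k + 2) = m * k) :
    StrictMonoOn (profile k m Λ) (Ioc 0 c) := by
  refine strictMonoOn_of_deriv_pos (convex_Ioc 0 c)
    ((continuousOn_profile k m Λ).mono Ioc_subset_Ioi_self) fun r hr => ?_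
  rw [interior_Ioc] at hr
  obtain ⟨h₀, h₁⟩ := hr
  rw [(hasDerivAt_profile k m Λ h₀).deriv, ← hc]
  have : r ^ (k + 2) < c ^ (k + 2) := pow_lt_pow_left₀ h₁ h₀.le (by omega)
  exact mul_pos (by positivity) (sub_pos.2 (by gcongr))

theorem strictAntiOn_profile {k : ℕ} {m Λ c : ℝ} (hΛ : 0 < Λ) (hc₀ : 0 < c)
    (hc : Λ * c ^ (k + 2) = m * k) : StrictAntiOn (profile k m Λ) (Ici c) := by
  refine strictAntiOn_of_deriv_neg (convex_Ici c)
    ((continuousOn_profile k m Λ).mono fun r hr => hc₀.trans_le hr) fun r hr => ?_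
  rw [interior_Ici] at hr
  have h₀ : 0 < r := hc₀.trans hr
  rw [(hasDerivAt_profile k m Λ h₀).deriv, ← hc]
  have : c ^ (k + 2) < r ^ (k + 2) := pow_lt_pow_left₀ hr hc₀.le (by omega)
  exact mul_neg_of_pos_of_neg (by positivity) (sub_neg.2 (by gcongr))

theorem profile_crit_pos {k : ℕ} {m Λ c : ℝ} (hk : k ≠ 0) (hc₀ : 0 < c)
    (hc : Λ * c ^ (k + 2) = m * k)
    (hsmall : m ^ 2 * Λ ^ k < (k : ℝ) ^ k / ((k : ℝ) + 2) ^ (k + 2)) :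
    0 < profile k m Λ c := by
  have hk₀ : (0 : ℝ) < k := by positivity
  have hval : profile k m Λ c = 1 - Λ * c ^ 2 * (k + 2) / k := by
    have hm : m = Λ * c ^ (k + 2) / k := by field_simp; linarith
    rw [profile, hm]
    field_simp
    ring
  have hpow : (Λ * c ^ 2 * (k + 2)) ^ (k + 2) < (k : ℝ) ^ (k + 2) := by
    rw [lt_div_iff₀ (by positivity)] at hsmall
    calc (Λ * c ^ 2 * (k + 2)) ^ (k + 2)
        = (Λ * c ^ (k + 2)) ^ 2 * Λ ^ k * ((k : ℝ) + 2) ^ (k + 2) := by rw [mul_pow]; ring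
      _ = (m ^ 2 * Λ ^ k * ((k : ℝ) + 2) ^ (k + 2)) * k ^ 2 := by rw [hc]; ring
      _ < (k : ℝ) ^ k * k ^ 2 := by gcongr
      _ = (k : ℝ) ^ (k + 2) := by ring
  rw [hval, sub_pos, div_lt_one hk₀]
  exact lt_of_pow_lt_pow_left₀ _ hk₀.le hpow

theorem profile_neg_of_le {k : ℕ} {m Λ r : ℝ} (hk : k ≠ 0) (hΛ : 0 < Λ) (hr : 0 < r)
    (hr₁ : r ≤ 1) (hrm : r ≤ m) : profile k m Λ r < 0 := by
  have hle : r ^ k ≤ m := (pow_le_of_le_one hr.le hr₁ hk).trans hrm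
  have : 1 ≤ 2 * m / r ^ k := by
    rw [le_div_iff₀ (by positivity)]
    linarith
  have : 0 < Λ * r ^ 2 := by positivity
  rw [profile]
  linarith

theorem profile_neg_of_ge {k : ℕ} {m Λ r : ℝ} (hm : 0 < m) (hΛ : 0 < Λ)
    (hr : 1 + 1 / Λ ≤ r) : profile k m Λ r < 0 := by
  have hΛ' : 0 < 1 / Λ := by positivity
  have hr₁ : 1 ≤ r := by linarith
  have : 1 ≤ Λ * r ^ 2 := by
    have : Λ * (1 / Λ) = 1 := by field_simp
    nlinarith [mul_le_mul_of_nonneg_left (le_self_pow₀ hr₁ two_ne_zero) hΛ.le]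
  have : 0 < 2 * m / r ^ k := by positivity
  rw [profile]
  linarith

/-- For `Λ > 0` with `m² Λ^(n-3) < (n-3)^(n-3)/(n-1)^(n-1)`, the function `f` has
exactly two positive zeros `r₀ < r* < r₁`, is positive on `(r₀, r₁)` and negative on
`(0, r₀)` and `(r₁, ∞)`. -/
theorem stmt_4 (n : ℕ) (hn : 4 ≤ n) (m Λ : ℝ) (hm : 0 < m) (hΛ : 0 < Λ)
    (hsmall : m ^ 2 * Λ ^ (n - 3) < ((n : ℝ) - 3) ^ (n - 3) / ((n : ℝ) - 1) ^ (n - 1))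
    (f : ℝ → ℝ)
    (hf : ∀ r : ℝ, 0 < r → f r = 1 - 2 * m * r ^ ((3 : ℤ) - (n : ℤ)) - Λ * r ^ 2)
    (rstar : ℝ) (hrs : rstar = (m * ((n : ℝ) - 3) / Λ) ^ (1 / ((n : ℝ) - 1))) :
    ∃ r₀ r₁ : ℝ, 0 < r₀ ∧ r₀ < rstar ∧ rstar < r₁ ∧
      f r₀ = 0 ∧ f r₁ = 0 ∧
      (∀ r ∈ Set.Ioo r₀ r₁, 0 < f r) ∧
      (∀ r ∈ Set.Ioo (0 : ℝ) r₀, f r < 0) ∧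
      (∀ r : ℝ, r₁ < r → f r < 0) ∧
      (∀ r : ℝ, 0 < r → f r = 0 → r = r₀ ∨ r = r₁) := by
  obtain ⟨k, rfl⟩ : ∃ k, n = k + 3 := ⟨n - 3, by omega⟩
  have hk : k ≠ 0 := by omega
  have hk₀ : (0 : ℝ) < k := by positivity
  have hsub : ((k + 3 : ℕ) : ℝ) - 3 = k := by push_cast; ring
  have hsub' : ((k + 3 : ℕ) : ℝ) - 1 = k + 2 := by push_cast; ring
  rw [hsub, hsub', Nat.add_sub_cancel, show k + 3 - 1 = k + 2 by omega] at hsmall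
  rw [hsub, hsub'] at hrs
  have hfp : ∀ r, 0 < r → f r = profile k m Λ r := by
    intro r hr
    rw [hf r hr, profile, show (3 : ℤ) - ((k + 3 : ℕ) : ℤ) = -(k : ℤ) by push_cast; ring,
      zpow_neg, zpow_natCast, div_eq_mul_inv]
  have hc₀ : 0 < rstar := hrs ▸ Real.rpow_pos_of_pos (by positivity) _
  have hc : Λ * rstar ^ (k + 2) = m * k := by
    have : ((k : ℝ) + 2) = ((k + 2 : ℕ) : ℝ) := by push_cast; ring
    rw [hrs, this, one_div, Real.rpow_inv_natCast_pow (by positivity) (by omega)]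
    field_simp
  obtain ⟨r₀, r₁, h₀, h₀c, hc₁, hz₀, hz₁, hpos, hneg₀, hneg₁⟩ := exists_two_zeros_of_unimodal
    (a := min rstar (min 1 m)) (b := max rstar (1 + 1 / Λ))
    (by positivity) (min_le_left _ _) (le_max_left _ _) (continuousOn_profile k m Λ)
    (strictMonoOn_profile hΛ hc) (strictAntiOn_profile hΛ hc₀ hc)
    (profile_neg_of_le hk hΛ (by positivity) ((min_le_right _ _).trans (min_le_left _ _))
      ((min_le_right _ _).trans (min_le_right _ _)))
    (profile_neg_of_ge hm hΛ (le_max_right _ _)) (profile_crit_pos hk hc₀ hc hsmall)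
  have h₁ : 0 < r₁ := hc₀.trans hc₁
  refine ⟨r₀, r₁, h₀, h₀c, hc₁, (hfp r₀ h₀).trans hz₀, (hfp r₁ h₁).trans hz₁,
    fun r hr => (hfp r (h₀.trans hr.1)).symm ▸ hpos r hr,
    fun r hr => (hfp r hr.1).symm ▸ hneg₀ r hr,
    fun r hr => (hfp r (h₁.trans hr)).symm ▸ hneg₁ r hr, fun r hr hfr => ?_⟩
  rw [hfp r hr] at hfr
  by_contra! hne
  rcases hne.1.lt_or_gt with h | h
  · exact (hneg₀ r ⟨hr, h⟩).ne hfr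
  · rcases hne.2.lt_or_gt with h' | h'
    · exact (hpos r ⟨h, h'⟩).ne' hfr
    · exact (hneg₁ r h').ne hfr
end

section
/- Let n ≥ 4 be an integer and m > 0, Λ real numbers. Let r₀ > 0 and r₁ > r₀ be real numbers with f(r₀) = 0, f(r) > 0 for all r ∈ (r₀, r₁), and (n−3)/r₀ − (n−1) Λ r₀ > 0, and set ℓ = ((n−3) r₀^{-1} − (n−1) Λ r₀)^{-1}. Then there exists a function F : ℝ → ℝ which is infinitely differentiable on the interval [r₀, r₁), satisfies F(r₀) = 0 and F'(r) > 0 for all r ∈ [r₀, r₁), and satisfies the identity ℓ · F'(r) · f(r) = F(r) for all r ∈ [r₀, r₁) (equivalently ℓ F'(r)/F(r) = 1/f(r) for r ∈ (r₀, r₁)). -/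
open Polynomial in
/-- A polynomial with a root `a` is `(X - a) * Q` with `Q(a)` its derivative at `a`. -/
theorem Polynomial.exists_eq_sub_mul_of_eval_eq_zero (P : ℝ[X]) (a : ℝ) (h : P.eval a = 0) :
    ∃ Q : ℝ[X], (∀ x, P.eval x = (x - a) * Q.eval x) ∧
      Q.eval a = (derivative P).eval a := by
  obtain ⟨Q, rfl⟩ := dvd_iff_isRoot.2 h
  exact ⟨Q, by simp, by simp [derivative_mul]⟩

/-- The primitive of a smooth function on an open interval is smooth. -/
theorem exists_contDiffOn_primitive_Ioo {a b c : ℝ} {h : ℝ → ℝ} (hc : c ∈ Set.Ioo a b)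
    (hh : ContDiffOn ℝ (⊤ : ℕ∞) h (Set.Ioo a b)) :
    ∃ H : ℝ → ℝ, ContDiffOn ℝ (⊤ : ℕ∞) H (Set.Ioo a b) ∧
      ∀ x ∈ Set.Ioo a b, HasDerivAt H (h x) x := by
  have hd : ∀ x ∈ Set.Ioo a b, HasDerivAt (fun x => ∫ t in c..x, h t) (h x) x := by
    intro x hx
    have hsub : Set.uIcc c x ⊆ Set.Ioo a b := Set.ordConnected_Ioo.uIcc_subset hc hx
    exact intervalIntegral.integral_hasDerivAt_right
      ((hh.continuousOn.mono hsub).intervalIntegrable)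
      (hh.continuousOn.stronglyMeasurableAtFilter isOpen_Ioo x hx)
      (hh.continuousOn.continuousAt (isOpen_Ioo.mem_nhds hx))
  refine ⟨_, ?_, hd⟩
  rw [contDiffOn_infty_iff_deriv_of_isOpen isOpen_Ioo]
  exact ⟨fun x hx => (hd x hx).differentiableAt.differentiableWithinAt,
    hh.congr fun x hx => (hd x hx).deriv⟩

open Polynomial in
/-- Existence of the desingularizing function `F`: smooth on `[r₀, r₁)`, vanishing at
`r₀`, with positive derivative, satisfying `ℓ F'(r) f(r) = F(r)`. -/
theorem stmt_8 (n : ℕ) (hn : 4 ≤ n) (m Λ : ℝ) (hm : 0 < m)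
    (f : ℝ → ℝ)
    (hf : ∀ r : ℝ, 0 < r → f r = 1 - 2 * m * r ^ ((3 : ℤ) - (n : ℤ)) - Λ * r ^ 2)
    (r₀ r₁ : ℝ) (hr₀ : 0 < r₀) (hr₀₁ : r₀ < r₁)
    (hz : f r₀ = 0) (hpos : ∀ r ∈ Set.Ioo r₀ r₁, 0 < f r)
    (hder : 0 < ((n : ℝ) - 3) / r₀ - ((n : ℝ) - 1) * Λ * r₀)
    (ℓ : ℝ) (hℓ : ℓ = (((n : ℝ) - 3) * r₀⁻¹ - ((n : ℝ) - 1) * Λ * r₀)⁻¹) :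
    ∃ F F' : ℝ → ℝ,
      ContDiffOn ℝ (⊤ : ℕ∞) F (Set.Ico r₀ r₁) ∧
      F r₀ = 0 ∧
      ∀ r ∈ Set.Ico r₀ r₁,
        HasDerivAt F (F' r) r ∧ 0 < F' r ∧ ℓ * F' r * f r = F r := by
  obtain ⟨k, rfl⟩ := Nat.exists_eq_add_of_le' hn
  rw [div_eq_mul_inv] at hder
  have hℓpos : 0 < ℓ := by rw [hℓ]; exact inv_pos.2 hder
  set P : ℝ[X] := X ^ (k + 1) - C (2 * m) - C Λ * X ^ (k + 3) with hP
  have hPf : ∀ r : ℝ, 0 < r → P.eval r = r ^ (k + 1) * f r := by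
    intro r hr
    have he : (3 : ℤ) - ((k + 4 : ℕ) : ℤ) = -((k + 1 : ℕ) : ℤ) := by push_cast; ring
    rw [hf r hr, he, zpow_neg, zpow_natCast]
    simp only [hP, eval_sub, eval_mul, eval_pow, eval_X, eval_C]
    field_simp
    ring
  obtain ⟨Q, hPQ, hQ₀⟩ := P.exists_eq_sub_mul_of_eval_eq_zero r₀ (by rw [hPf r₀ hr₀, hz, mul_zero])
  have hℓQ : ℓ * Q.eval r₀ = r₀ ^ (k + 1) := by
    have hQ : Q.eval r₀ =
        r₀ ^ (k + 1) * ((((k + 4 : ℕ) : ℝ) - 3) * r₀⁻¹ - (((k + 4 : ℕ) : ℝ) - 1) * Λ * r₀) := by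
      rw [hQ₀]
      simp only [hP, derivative_sub, derivative_X_pow, derivative_C, derivative_C_mul, eval_sub,
        eval_mul, eval_pow, eval_X, eval_C, eval_zero, Nat.add_sub_cancel]
      push_cast
      field_simp
      simp
      ring
    rw [hQ, hℓ, mul_left_comm, inv_mul_cancel₀ hder.ne', mul_one]
  have hQ₀pos : 0 < Q.eval r₀ := by
    have : 0 < ℓ * Q.eval r₀ := hℓQ ▸ by positivity
    exact pos_of_mul_pos_right this hℓpos.le
  have hQpos : ∀ r ∈ Set.Ico r₀ r₁, 0 < Q.eval r := by
    intro r hr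
    rcases hr.1.eq_or_lt with rfl | h
    · exact hQ₀pos
    · have h1 : 0 < (r - r₀) * Q.eval r := by
        rw [← hPQ, hPf r (hr₀.trans h)]
        exact mul_pos (pow_pos (hr₀.trans h) _) (hpos r ⟨h, hr.2⟩)
      exact pos_of_mul_pos_right h1 (sub_pos.2 h).le
  obtain ⟨K, hK, -⟩ := (X ^ (k + 1) - C ℓ * Q).exists_eq_sub_mul_of_eval_eq_zero r₀
    (by simp [hℓQ])
  simp only [eval_sub, eval_mul, eval_pow, eval_X, eval_C] at hK
  obtain ⟨a, ha, haQ⟩ : ∃ a < r₀, ∀ r ∈ Set.Ioc a r₀, 0 < Q.eval r :=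
    exists_Ioc_subset_of_mem_nhds (Q.continuous.continuousAt.eventually_const_lt hQ₀pos)
      ⟨r₀ - 1, by simp⟩
  have hQI : ∀ r ∈ Set.Ioo a r₁, 0 < Q.eval r := fun r hr =>
    (le_total r r₀).elim (fun h => haQ r ⟨hr.1, h⟩) fun h => hQpos r ⟨h, hr.2⟩
  have hsmooth : ∀ p : ℝ[X], ContDiff ℝ (⊤ : ℕ∞) fun r => p.eval r := fun p => by
    simpa using p.contDiff_aeval (𝕜 := ℝ) _
  obtain ⟨H, hH, hHd⟩ := exists_contDiffOn_primitive_Ioo (c := r₀)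
    (h := fun r => K.eval r / (ℓ * Q.eval r)) ⟨ha, hr₀₁⟩
    ((hsmooth K).contDiffOn.div (contDiffOn_const.mul (hsmooth Q).contDiffOn)
      fun r hr => (mul_pos hℓpos (hQI r hr)).ne')
  have hsub : Set.Ico r₀ r₁ ⊆ Set.Ioo a r₁ := fun r hr => ⟨ha.trans_le hr.1, hr.2⟩
  refine ⟨fun r => (r - r₀) * Real.exp (H r),
    fun r => Real.exp (H r) * (r ^ (k + 1) / (ℓ * Q.eval r)),
    (contDiffOn_id.sub contDiffOn_const).mul (hH.mono hsub).exp, by simp, fun r hr => ?_⟩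
  have hr' : 0 < r := hr₀.trans_le hr.1
  have hq := hQpos r hr
  refine ⟨?_, by positivity, ?_⟩
  · refine (((hasDerivAt_id' r).sub_const r₀).fun_mul (hHd r (hsub hr)).exp).congr_deriv ?_
    field_simp
    linear_combination -hK r
  · have h1 : r ^ (k + 1) * f r = (r - r₀) * Q.eval r := by rw [← hPf r hr', hPQ]
    field_simp
    linear_combination h1
end
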